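/- Let J : S → ℝ and K : T → ℝ be Daniell integrals with unique extensions J̄ : L(S) → ℝ, K̄ : L(T) → ℝ to the generated Lebesgue lattices, and let I be the product integral on R(S ⊗ T). Then for every f ∈ R(S ⊗ T): f(x,·) ∈ L(T) for all x, the function K̄f : x ↦ K̄(f(x,·)) lies in L(S), and I(f) = J̄(K̄f); symmetrically f(·,y) ∈ L(S) for all y, J̄f ∈ L(T), and I(f) = K̄(J̄f). In particular J̄(K̄f) = K̄(J̄f) (Fubini-type theorem). -/

import Mathlib

open Filter Topology

/-- `Pdom M`: dominated pointwise limits of sequences in `M`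
(sequence `f₀, f₁, …` with `|fₙ| ≤ f₀` for `n ≥ 1`, converging pointwise). -/
def Pdom {Z : Type*} (M : Set (Z → ℝ)) : Set (Z → ℝ) :=
  { f | ∃ F : ℕ → Z → ℝ, (∀ n, F n ∈ M) ∧ (∀ n, |F (n + 1)| ≤ F 0) ∧
      ∀ z, Tendsto (fun n => F n z) atTop (𝓝 (f z)) }

/-- `U` is a vector subspace of the functions `Z → ℝ`. -/
def IsSubspace {Z : Type*} (U : Set (Z → ℝ)) : Prop :=
  (0 : Z → ℝ) ∈ U ∧ (∀ f g, f ∈ U → g ∈ U → f + g ∈ U) ∧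
    ∀ (c : ℝ) (f), f ∈ U → c • f ∈ U

/-- A Riesz space of functions: a subspace closed under pointwise absolute value. -/
def IsRiesz {Z : Type*} (R : Set (Z → ℝ)) : Prop :=
  IsSubspace R ∧ ∀ f, f ∈ R → |f| ∈ R

/-- A Lebesgue lattice: a Riesz space closed under dominated pointwise limits. -/
def IsLebesgue {Z : Type*} (L : Set (Z → ℝ)) : Prop :=
  IsRiesz L ∧ Pdom L ⊆ L

/-- smallest Riesz space containing `M`. -/
def RGen {Z : Type*} (M : Set (Z → ℝ)) : Set (Z → ℝ) :=
  ⋂₀ { R | IsRiesz R ∧ M ⊆ R }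

/-- smallest Lebesgue lattice containing `M`. -/
def LGen {Z : Type*} (M : Set (Z → ℝ)) : Set (Z → ℝ) :=
  ⋂₀ { L | IsLebesgue L ∧ M ⊆ L }

/-- Daniell integral on `R`: additive, homogeneous, monotone, continuous under
decreasing convergence to `0`. -/
def IsDaniell {Z : Type*} (R : Set (Z → ℝ)) (I : (Z → ℝ) → ℝ) : Prop :=
  IsRiesz R ∧
  (∀ f g, f ∈ R → g ∈ R → I (f + g) = I f + I g) ∧
  (∀ (c : ℝ) (f), f ∈ R → I (c • f) = c * I f) ∧
  (∀ f, f ∈ R → I f ≤ I |f|) ∧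
  ∀ F : ℕ → Z → ℝ, (∀ n, F n ∈ R) → (∀ n, 0 ≤ F (n + 1)) →
    (∀ n, F (n + 1) ≤ F n) →
    (∀ z, Tendsto (fun n => F n z) atTop (𝓝 0)) →
    Tendsto (fun n => I (F n)) atTop (𝓝 0)

/-- elementary tensor `(g ⊗ h)(x, y) = g x * h y`. -/
def tensor {X Y : Type*} (g : X → ℝ) (h : Y → ℝ) : X × Y → ℝ :=
  fun p => g p.1 * h p.2

/-- tensor product `V ⊗ W`: finite sums of elementary tensors. -/
def TensorSet {X Y : Type*} (V : Set (X → ℝ)) (W : Set (Y → ℝ)) :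
    Set (X × Y → ℝ) :=
  { f | ∃ (k : ℕ) (g : Fin k → X → ℝ) (h : Fin k → Y → ℝ),
      (∀ i, g i ∈ V) ∧ (∀ i, h i ∈ W) ∧ f = ∑ i, tensor (g i) (h i) }

/-- `iterP U m`: `U₁ = U`, `U_{m+1} = P(U_m)` (0-indexed). -/
def iterP {Z : Type*} (U : Set (Z → ℝ)) : ℕ → Set (Z → ℝ)
  | 0 => U
  | n + 1 => Pdom (iterP U n)

namespace Fub

variable {Z : Type*}

lemma IsSubspace.sum {R : Set (Z → ℝ)} (h : IsSubspace R) {k : ℕ} (f : Fin k → Z → ℝ)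
    (hf : ∀ i, f i ∈ R) : ∑ i, f i ∈ R :=
  Finset.sum_induction f (· ∈ R) (fun a b => h.2.1 a b) h.1 (fun i _ => hf i)

lemma sub_mem {R : Set (Z → ℝ)} (h : IsSubspace R) {f g : Z → ℝ} (hf : f ∈ R) (hg : g ∈ R) :
    f - g ∈ R := by
  have := h.2.1 f _ hf (h.2.2 (-1) g hg)
  have e : f + (-1 : ℝ) • g = f - g := by ext; simp; ring
  rwa [e] at this

lemma D_sub {R : Set (Z → ℝ)} {I : (Z → ℝ) → ℝ} (h : IsDaniell R I) {f g : Z → ℝ}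
    (hf : f ∈ R) (hg : g ∈ R) : I (f - g) = I f - I g := by
  have e : f - g = f + (-1 : ℝ) • g := by ext; simp; ring
  rw [e, h.2.1 _ _ hf (h.1.1.2.2 _ _ hg), h.2.2.1 _ _ hg]; ring

lemma D_nonneg {R : Set (Z → ℝ)} {I : (Z → ℝ) → ℝ} (h : IsDaniell R I) {f : Z → ℝ}
    (hf : f ∈ R) (h0 : 0 ≤ f) : 0 ≤ I f := by
  have h1 := h.2.2.2.1 _ (h.1.1.2.2 (-1) f hf)
  rw [h.2.2.1 _ _ hf] at h1
  have e : |(-1 : ℝ) • f| = f := by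
    ext z; simpa using h0 z
  rw [e] at h1; linarith

lemma D_mono {R : Set (Z → ℝ)} {I : (Z → ℝ) → ℝ} (h : IsDaniell R I) {f g : Z → ℝ}
    (hf : f ∈ R) (hg : g ∈ R) (hfg : f ≤ g) : I f ≤ I g := by
  have := D_nonneg h (sub_mem h.1.1 hg hf) (sub_nonneg.2 hfg)
  rw [D_sub h hg hf] at this; linarith

lemma D_abs {R : Set (Z → ℝ)} {I : (Z → ℝ) → ℝ} (h : IsDaniell R I) {f g w : Z → ℝ}
    (hf : f ∈ R) (hg : g ∈ R) (hw : w ∈ R) (hfg : ∀ z, |f z - g z| ≤ w z) :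
    |I f - I g| ≤ I w := by
  have h1 := D_mono h (sub_mem h.1.1 hf hg) hw (fun z => (abs_le.1 (hfg z)).2)
  have h2 := D_mono h (sub_mem h.1.1 hg hf) hw
    (fun z => by have := (abs_le.1 (hfg z)).1; simp only [Pi.sub_apply]; linarith)
  rw [D_sub h hf hg] at h1
  rw [D_sub h hg hf] at h2
  rw [abs_le]; constructor <;> linarith

lemma D_zero {R : Set (Z → ℝ)} {I : (Z → ℝ) → ℝ} (h : IsDaniell R I) : I 0 = 0 := by
  have := h.2.2.1 0 0 h.1.1.1
  simpa using this

lemma D_sum {R : Set (Z → ℝ)} {I : (Z → ℝ) → ℝ} (h : IsDaniell R I) :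
    ∀ {k : ℕ} (f : Fin k → Z → ℝ) (_ : ∀ i, f i ∈ R), I (∑ i, f i) = ∑ i, I (f i)
  | 0, f, hf => by simpa using D_zero h
  | k + 1, f, hf => by
    rw [Fin.sum_univ_succ, Fin.sum_univ_succ, h.2.1 _ _ (hf 0)
      (IsSubspace.sum h.1.1 _ (fun i => hf i.succ)), D_sum h _ (fun i => hf i.succ)]

lemma LGen_sub (M : Set (Z → ℝ)) : M ⊆ LGen M := fun _ hf _ hL => hL.2 hf
lemma RGen_sub (M : Set (Z → ℝ)) : M ⊆ RGen M := fun _ hf _ hL => hL.2 hf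

lemma LGen_Pdom (M : Set (Z → ℝ)) : Pdom (LGen M) ⊆ LGen M := by
  rintro f ⟨F, h1, h2, h3⟩ L hL
  exact hL.1.2 ⟨F, fun n => h1 n L hL, h2, h3⟩

/-- bounded multipliers `p` such that `p * u` is a relatively uniform limit from `S`. -/
def Mul (S : Set (Z → ℝ)) (u : Z → ℝ) : Set (Z → ℝ) :=
  { p | (∃ C, ∀ x, |p x| ≤ C) ∧ ∀ ε > 0, ∃ s ∈ S, ∀ x, |p x * u x - s x| ≤ ε * u x }

section
variable {S : Set (Z → ℝ)} {u : Z → ℝ}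

lemma Mul_const (hS : IsRiesz S) (hu : u ∈ S) (h0 : 0 ≤ u) (c : ℝ) : (fun _ => c) ∈ Mul S u := by
  refine ⟨⟨|c|, fun _ => le_rfl⟩, fun ε hε => ⟨c • u, hS.1.2.2 _ _ hu, fun x => ?_⟩⟩
  have := h0 x
  simpa using mul_nonneg hε.le this

lemma Mul_add (hS : IsRiesz S) {p q : Z → ℝ} (hp : p ∈ Mul S u) (hq : q ∈ Mul S u) :
    p + q ∈ Mul S u := by
  obtain ⟨⟨C, hC⟩, hp⟩ := hp
  obtain ⟨⟨D, hD⟩, hq⟩ := hq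
  refine ⟨⟨C + D, fun x => (abs_add_le _ _).trans (add_le_add (hC x) (hD x))⟩, fun ε hε => ?_⟩
  obtain ⟨s, hs, h1⟩ := hp (ε/2) (by positivity)
  obtain ⟨t, ht, h2⟩ := hq (ε/2) (by positivity)
  refine ⟨s + t, hS.1.2.1 _ _ hs ht, fun x => ?_⟩
  have h1 := abs_le.1 (h1 x)
  have h2 := abs_le.1 (h2 x)
  simp only [Pi.add_apply]
  rw [abs_le]; constructor <;> linarith

lemma Mul_smul (hS : IsRiesz S) (h0 : 0 ≤ u) {p : Z → ℝ} (c : ℝ) (hp : p ∈ Mul S u) :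
    c • p ∈ Mul S u := by
  obtain ⟨⟨C, hC⟩, hp⟩ := hp
  refine ⟨⟨|c| * C, fun x => ?_⟩, fun ε hε => ?_⟩
  · simp only [Pi.smul_apply, smul_eq_mul, abs_mul]
    exact mul_le_mul_of_nonneg_left (hC x) (abs_nonneg c)
  obtain ⟨s, hs, h1⟩ := hp (ε/(|c|+1)) (by positivity)
  refine ⟨c • s, hS.1.2.2 _ _ hs, fun x => ?_⟩
  simp only [Pi.smul_apply, smul_eq_mul]
  rw [show c * p x * u x - c * s x = c * (p x * u x - s x) by ring, abs_mul]
  have hu := h0 x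
  simp only [Pi.zero_apply] at hu
  calc |c| * |p x * u x - s x| ≤ (|c| + 1) * (ε/(|c|+1) * u x) :=
        mul_le_mul (by linarith) (h1 x) (abs_nonneg _) (by positivity)
    _ = ε * u x := by field_simp

lemma Mul_abs (hS : IsRiesz S) (h0 : 0 ≤ u) {p : Z → ℝ} (hp : p ∈ Mul S u) :
    |p| ∈ Mul S u := by
  obtain ⟨⟨C, hC⟩, hp⟩ := hp
  refine ⟨⟨C, fun x => by simpa using hC x⟩, fun ε hε => ?_⟩
  obtain ⟨s, hs, h1⟩ := hp ε hε
  refine ⟨|s|, hS.2 _ hs, fun x => ?_⟩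
  refine le_trans ?_ (h1 x)
  have := abs_abs_sub_abs_le (p x * u x) (s x)
  rwa [abs_mul, abs_of_nonneg (h0 x)] at this

lemma Mul_sup (hS : IsRiesz S) (h0 : 0 ≤ u) {p q : Z → ℝ} (hp : p ∈ Mul S u)
    (hq : q ∈ Mul S u) : p ⊔ q ∈ Mul S u := by
  have e : p ⊔ q = (1/2 : ℝ) • ((p + q) + |p + (-1 : ℝ) • q|) := by
    ext x
    simp only [Pi.sup_apply, Pi.smul_apply, Pi.add_apply, Pi.abs_apply, smul_eq_mul]
    rcases le_total (p x) (q x) with h | h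
    · rw [sup_of_le_right h, abs_of_nonpos (by linarith)]; ring
    · rw [sup_of_le_left h, abs_of_nonneg (by linarith)]; ring
  rw [e]
  exact Mul_smul hS h0 _ (Mul_add hS (Mul_add hS hp hq)
    (Mul_abs hS h0 (Mul_add hS hp (Mul_smul hS h0 _ hq))))

lemma Mul_lim (h0 : 0 ≤ u) {p : Z → ℝ}
    (hp : ∀ ε > 0, ∃ q ∈ Mul S u, ∀ x, |p x - q x| ≤ ε) : p ∈ Mul S u := by
  constructor
  · obtain ⟨q, ⟨⟨C, hC⟩, -⟩, h⟩ := hp 1 one_pos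
    refine ⟨C + 1, fun x => ?_⟩
    have := abs_sub_abs_le_abs_sub (p x) (q x)
    linarith [h x, hC x]
  · intro ε hε
    obtain ⟨q, ⟨-, hq⟩, h⟩ := hp (ε/2) (by positivity)
    obtain ⟨s, hs, h1⟩ := hq (ε/2) (by positivity)
    refine ⟨s, hs, fun x => ?_⟩
    have hu : 0 ≤ u x := h0 x
    have h2 : |(p x - q x) * u x| ≤ ε/2 * u x := by
      rw [abs_mul, abs_of_nonneg hu]
      exact mul_le_mul_of_nonneg_right (h x) hu
    have := abs_add_le ((p x - q x) * u x) (q x * u x - s x)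
    rw [show p x * u x - s x = (p x - q x) * u x + (q x * u x - s x) by ring]
    linarith [h1 x]

lemma Mul_sq (hS : IsRiesz S) (hu : u ∈ S) (h0 : 0 ≤ u) {p : Z → ℝ} (hp : p ∈ Mul S u) :
    p * p ∈ Mul S u := by
  obtain ⟨C, hC⟩ := hp.1
  refine Mul_lim h0 fun ε hε => ?_
  obtain ⟨δ, hδ, hδε⟩ : ∃ δ : ℝ, 0 < δ ∧ δ * δ ≤ ε := by
    refine ⟨Real.sqrt ε, Real.sqrt_pos.2 hε, (Real.mul_self_sqrt hε.le).le⟩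
  obtain ⟨N, hN⟩ := exists_nat_gt (C / δ + 1)
  let G : ℤ → Z → ℝ := fun j => (2 * (j * δ)) • p + (fun _ => - (j * δ)^2)
  have hne : (Finset.Icc (-(N : ℤ)) N).Nonempty := ⟨0, by simp⟩
  refine ⟨(Finset.Icc (-(N : ℤ)) N).sup' hne G, ?_, fun x => ?_⟩
  · refine Finset.sup'_induction hne G (p := (· ∈ Mul S u))
      (fun a ha b hb => Mul_sup hS h0 ha hb) (fun j _ => ?_)
    exact Mul_add hS (Mul_smul hS h0 _ hp) (Mul_const hS hu h0 _)
  · rw [Finset.sup'_apply]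
    have hG : ∀ j : ℤ, G j x = p x * p x - (p x - j * δ)^2 := fun j => by
      simp only [G, Pi.add_apply, Pi.smul_apply, smul_eq_mul]; ring
    have hup : (Finset.Icc (-(N : ℤ)) N).sup' hne (fun j => G j x) ≤ p x * p x := by
      refine Finset.sup'_le _ _ fun j _ => ?_
      rw [hG]; nlinarith [sq_nonneg (p x - j * δ)]
    have hr := abs_sub_round (p x / δ)
    set j := round (p x / δ) with hj
    have hpd : |p x / δ| ≤ C / δ := by
      rw [abs_div, abs_of_pos hδ]; exact div_le_div_of_nonneg_right (hC x) hδ.le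
    have hjm : j ∈ Finset.Icc (-(N : ℤ)) N := by
      rw [Finset.mem_Icc]
      have a := abs_le.1 hr
      have b := abs_le.1 hpd
      constructor
      · have : (-(N:ℝ)) ≤ j := by linarith
        exact_mod_cast this
      · have : (j:ℝ) ≤ N := by linarith
        exact_mod_cast this
    have hlow := Finset.le_sup' (fun j => G j x) hjm
    simp only [hG] at hlow hup ⊢
    have h3 : (p x - j * δ)^2 ≤ δ * δ := by
      have e : p x - j * δ = (p x / δ - j) * δ := by field_simp
      rw [e, mul_pow]
      have : (p x / δ - j)^2 ≤ 1 := by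
        rw [← sq_abs]; nlinarith [abs_nonneg (p x / δ - j)]
      nlinarith [mul_pos hδ hδ]
    simp only [Pi.mul_apply]
    rw [abs_of_nonneg (by linarith)]
    linarith

lemma Mul_mul (hS : IsRiesz S) (hu : u ∈ S) (h0 : 0 ≤ u) {p q : Z → ℝ} (hp : p ∈ Mul S u)
    (hq : q ∈ Mul S u) : p * q ∈ Mul S u := by
  have e : p * q = (1/4 : ℝ) • ((p + q) * (p + q) +
      (-1 : ℝ) • ((p + (-1 : ℝ) • q) * (p + (-1 : ℝ) • q))) := by
    ext x
    simp only [Pi.mul_apply, Pi.smul_apply, Pi.add_apply, smul_eq_mul]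
    ring
  rw [e]
  exact Mul_smul hS h0 _ (Mul_add hS (Mul_sq hS hu h0 (Mul_add hS hp hq))
    (Mul_smul hS h0 _ (Mul_sq hS hu h0 (Mul_add hS hp (Mul_smul hS h0 _ hq)))))

lemma Mul_div (h0 : 0 ≤ u) {g : Z → ℝ} (hg : g ∈ S) (hgu : |g| ≤ u) :
    (fun x => g x / u x) ∈ Mul S u := by
  have hgu : ∀ x, |g x| ≤ u x := hgu
  refine ⟨⟨1, fun x => ?_⟩, fun ε hε => ⟨g, hg, fun x => ?_⟩⟩
  · rw [abs_div, abs_of_nonneg (h0 x)]; exact div_le_one_of_le₀ (hgu x) (h0 x)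
  · have hu : 0 ≤ u x := h0 x
    rw [div_mul_cancel_of_imp, sub_self, abs_zero]
    · positivity
    · intro h; have := hgu x; rw [h] at this; exact abs_nonpos_iff.1 this

end

section
variable {X Y : Type*} {S : Set (X → ℝ)} {T : Set (Y → ℝ)} {u : X → ℝ} {v : Y → ℝ}

lemma Tens_add {t t' : X × Y → ℝ} (h : t ∈ TensorSet S T) (h' : t' ∈ TensorSet S T) :
    t + t' ∈ TensorSet S T := by
  obtain ⟨k, g, h, hg, hh, rfl⟩ := h
  obtain ⟨k', g', h', hg', hh', rfl⟩ := h'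
  refine ⟨k + k', Fin.append g g', Fin.append h h', ?_, ?_, ?_⟩
  · intro i; refine Fin.addCases (fun i => ?_) (fun i => ?_) i <;> simp [hg, hg']
  · intro i; refine Fin.addCases (fun i => ?_) (fun i => ?_) i <;> simp [hh, hh']
  · simp [Fin.sum_univ_add]

lemma Tens_smul (hS : IsRiesz S) {t : X × Y → ℝ} (c : ℝ) (h : t ∈ TensorSet S T) :
    c • t ∈ TensorSet S T := by
  obtain ⟨k, g, h, hg, hh, rfl⟩ := h
  refine ⟨k, fun i => c • g i, h, fun i => hS.1.2.2 _ _ (hg i), hh, ?_⟩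
  rw [Finset.smul_sum]
  refine Finset.sum_congr rfl fun i _ => ?_
  ext z; simp [tensor, mul_assoc]

lemma Tens_one {g : X → ℝ} {h : Y → ℝ} (hg : g ∈ S) (hh : h ∈ T) :
    tensor g h ∈ TensorSet S T :=
  ⟨1, fun _ => g, fun _ => h, fun _ => hg, fun _ => hh, by simp⟩

lemma Tens_zero : (0 : X × Y → ℝ) ∈ TensorSet S T :=
  ⟨0, Fin.elim0, Fin.elim0, fun i => i.elim0, fun i => i.elim0, by simp⟩

/-- the monoid of elementary products of multipliers -/
def Mon (hS : IsRiesz S) (hT : IsRiesz T) (hu : u ∈ S) (hv : v ∈ T) (hu0 : 0 ≤ u) (hv0 : 0 ≤ v) :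
    Submonoid (X × Y → ℝ) where
  carrier := { F | ∃ p ∈ Mul S u, ∃ q ∈ Mul T v, F = tensor p q }
  one_mem' := ⟨_, Mul_const hS hu hu0 1, _, Mul_const hT hv hv0 1, by ext; simp [tensor]⟩
  mul_mem' := by
    rintro _ _ ⟨p, hp, q, hq, rfl⟩ ⟨p', hp', q', hq', rfl⟩
    refine ⟨p * p', Mul_mul hS hu hu0 hp hp', q * q', Mul_mul hT hv hv0 hq hq', ?_⟩
    ext z; simp [tensor]; ring

/-- the algebra generated by elementary products of multipliers -/
def Alg (hS : IsRiesz S) (hT : IsRiesz T) (hu : u ∈ S) (hv : v ∈ T) (hu0 : 0 ≤ u) (hv0 : 0 ≤ v) :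
    Subalgebra ℝ (X × Y → ℝ) :=
  Algebra.adjoin ℝ (Mon hS hT hu hv hu0 hv0 : Set (X × Y → ℝ))

/-- functions that are bounded and approximable from the tensors -/
def App (S : Set (X → ℝ)) (T : Set (Y → ℝ)) (u : X → ℝ) (v : Y → ℝ) : Set (X × Y → ℝ) :=
  { F | (∃ C, ∀ z, |F z| ≤ C) ∧ ∀ ε > 0, ∃ t ∈ TensorSet S T,
      ∀ z, |F z * (u z.1 * v z.2) - t z| ≤ ε * (u z.1 * v z.2) }

lemma App_tensor (hu0 : 0 ≤ u) (hv0 : 0 ≤ v) {p : X → ℝ} {q : Y → ℝ} (hp : p ∈ Mul S u)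
    (hq : q ∈ Mul T v) : tensor p q ∈ App S T u v := by
  obtain ⟨⟨C, hC⟩, hp⟩ := hp
  obtain ⟨⟨D, hD⟩, hq⟩ := hq
  refine ⟨⟨|C| * |D|, fun z => ?_⟩, fun ε hε => ?_⟩
  · simp only [tensor, abs_mul]
    exact mul_le_mul ((hC _).trans (le_abs_self C)) ((hD _).trans (le_abs_self D))
      (abs_nonneg _) (abs_nonneg _)
  obtain ⟨δ, hδ, hδ1, hδε⟩ : ∃ δ : ℝ, 0 < δ ∧ δ ≤ 1 ∧ δ * (|C| + |D| + 1) ≤ ε := by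
    refine ⟨min 1 (ε / (|C| + |D| + 1)), by positivity, min_le_left _ _, ?_⟩
    rw [← le_div_iff₀ (by positivity)]; exact min_le_right _ _
  obtain ⟨s, hs, h1⟩ := hp δ hδ
  obtain ⟨t, ht, h2⟩ := hq δ hδ
  refine ⟨tensor s t, Tens_one hs ht, fun ⟨x, y⟩ => ?_⟩
  have h1 := h1 x
  have h2 := h2 y
  have hu : 0 ≤ u x := hu0 x
  have hv : 0 ≤ v y := hv0 y
  simp only [tensor]
  have e : p x * q y * (u x * v y) - s x * t y
    = (p x * u x) * (q y * v y - t y) + (p x * u x - s x) * t y := by ring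
  have ht : |t y| ≤ (|D| + 1) * v y := by
    have a := abs_sub_abs_le_abs_sub (t y) (q y * v y)
    rw [abs_sub_comm] at a
    have b : |q y * v y| ≤ |D| * v y := by
      rw [abs_mul, abs_of_nonneg hv]
      exact mul_le_mul_of_nonneg_right ((hD y).trans (le_abs_self D)) hv
    nlinarith
  have hpu : |p x * u x| ≤ |C| * u x := by
    rw [abs_mul, abs_of_nonneg hu]
    exact mul_le_mul_of_nonneg_right ((hC x).trans (le_abs_self C)) hu
  rw [e]
  calc _ ≤ |p x * u x| * |q y * v y - t y| + |p x * u x - s x| * |t y| := by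
        rw [← abs_mul, ← abs_mul]; exact abs_add_le _ _
    _ ≤ (|C| * u x) * (δ * v y) + (δ * u x) * ((|D| + 1) * v y) := by
        gcongr
    _ = (δ * (|C| + |D| + 1)) * (u x * v y) := by ring
    _ ≤ ε * (u x * v y) := mul_le_mul_of_nonneg_right hδε (mul_nonneg hu hv)

lemma App_add {F G : X × Y → ℝ} (hF : F ∈ App S T u v) (hG : G ∈ App S T u v) :
    F + G ∈ App S T u v := by
  obtain ⟨⟨C, hC⟩, hp⟩ := hF
  obtain ⟨⟨D, hD⟩, hq⟩ := hG
  refine ⟨⟨C + D, fun x => (abs_add_le _ _).trans (add_le_add (hC x) (hD x))⟩, fun ε hε => ?_⟩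
  obtain ⟨s, hs, h1⟩ := hp (ε/2) (by positivity)
  obtain ⟨t, ht, h2⟩ := hq (ε/2) (by positivity)
  refine ⟨s + t, Tens_add hs ht, fun x => ?_⟩
  have h1 := abs_le.1 (h1 x)
  have h2 := abs_le.1 (h2 x)
  simp only [Pi.add_apply]
  rw [abs_le]; constructor <;> linarith

lemma App_smul (hS : IsRiesz S) (hu0 : 0 ≤ u) (hv0 : 0 ≤ v) {F : X × Y → ℝ} (c : ℝ)
    (hp : F ∈ App S T u v) : c • F ∈ App S T u v := by
  obtain ⟨⟨C, hC⟩, hp⟩ := hp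
  refine ⟨⟨|c| * C, fun x => ?_⟩, fun ε hε => ?_⟩
  · simp only [Pi.smul_apply, smul_eq_mul, abs_mul]
    exact mul_le_mul_of_nonneg_left (hC x) (abs_nonneg c)
  obtain ⟨s, hs, h1⟩ := hp (ε/(|c|+1)) (by positivity)
  refine ⟨c • s, Tens_smul hS _ hs, fun x => ?_⟩
  simp only [Pi.smul_apply, smul_eq_mul]
  have hw : 0 ≤ u x.1 * v x.2 := mul_nonneg (hu0 _) (hv0 _)
  have h1 := h1 x
  set w := u x.1 * v x.2
  rw [show c * F x * w - c * s x = c * (F x * w - s x) by ring, abs_mul]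
  calc |c| * |F x * w - s x| ≤ (|c| + 1) * (ε/(|c|+1) * w) :=
        mul_le_mul (by linarith) h1 (abs_nonneg _) (by positivity)
    _ = ε * w := by field_simp

lemma Alg_le_App (hS : IsRiesz S) (hT : IsRiesz T) (hu : u ∈ S) (hv : v ∈ T) (hu0 : 0 ≤ u)
    (hv0 : 0 ≤ v) {F : X × Y → ℝ} (hF : F ∈ Alg hS hT hu hv hu0 hv0) : F ∈ App S T u v := by
  replace hF : F ∈ Subalgebra.toSubmodule (Alg hS hT hu hv hu0 hv0) := hF
  rw [Alg, Algebra.adjoin_eq_span, Submonoid.closure_eq] at hF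
  induction hF using Submodule.span_induction with
  | mem x h =>
    obtain ⟨p, hp, q, hq, rfl⟩ := h
    exact App_tensor hu0 hv0 hp hq
  | zero =>
    refine ⟨⟨0, by simp⟩, fun ε hε => ⟨0, Tens_zero, fun z => ?_⟩⟩
    simpa using mul_nonneg hε.le (mul_nonneg (hu0 z.1) (hv0 z.2))
  | add x y _ _ hx hy => exact App_add hx hy
  | smul a x _ hx => exact App_smul hS hu0 hv0 a hx

/-- uniform closure of the algebra -/
def Cl (hS : IsRiesz S) (hT : IsRiesz T) (hu : u ∈ S) (hv : v ∈ T) (hu0 : 0 ≤ u) (hv0 : 0 ≤ v) :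
    Set (X × Y → ℝ) :=
  { F | ∀ ε > 0, ∃ G ∈ Alg hS hT hu hv hu0 hv0, ∀ z, |F z - G z| ≤ ε }

lemma Cl_abs (hS : IsRiesz S) (hT : IsRiesz T) (hu : u ∈ S) (hv : v ∈ T) (hu0 : 0 ≤ u)
    (hv0 : 0 ≤ v) {F : X × Y → ℝ} (hF : F ∈ Cl hS hT hu hv hu0 hv0) :
    |F| ∈ Cl hS hT hu hv hu0 hv0 := by
  intro ε hε
  obtain ⟨G, hG, h⟩ := hF (ε/2) (by positivity)
  obtain ⟨C, hC⟩ := (Alg_le_App hS hT hu hv hu0 hv0 hG).1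
  obtain ⟨P, hP⟩ := exists_polynomial_near_of_continuousOn (-C) C (fun x => |x|)
    continuous_abs.continuousOn (ε/2) (by positivity)
  refine ⟨Polynomial.aeval G P, Polynomial.aeval_mem_adjoin_singleton ℝ G |> fun h => Algebra.adjoin_le (Set.singleton_subset_iff.2 hG) h, fun z => ?_⟩
  have e : (Polynomial.aeval G P) z = P.eval (G z) := by
    have := Polynomial.aeval_algHom_apply (Pi.evalAlgHom ℝ (fun _ : X × Y => ℝ) z) G P
    simpa using this.symm
  rw [e]
  have h1 := hP (G z) (abs_le.1 (hC z))
  have h2 := (abs_abs_sub_abs_le (F z) (G z)).trans (h z)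
  rw [abs_sub_comm] at h1
  have := abs_sub_le |F z| |G z| (P.eval (G z))
  simp only [Pi.abs_apply]
  linarith

lemma Cl_add (hS : IsRiesz S) (hT : IsRiesz T) (hu : u ∈ S) (hv : v ∈ T) (hu0 : 0 ≤ u)
    (hv0 : 0 ≤ v) {F G : X × Y → ℝ} (hF : F ∈ Cl hS hT hu hv hu0 hv0)
    (hG : G ∈ Cl hS hT hu hv hu0 hv0) : F + G ∈ Cl hS hT hu hv hu0 hv0 := by
  intro ε hε
  obtain ⟨s, hs, h1⟩ := hF (ε/2) (by positivity)
  obtain ⟨t, ht, h2⟩ := hG (ε/2) (by positivity)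
  refine ⟨s + t, add_mem hs ht, fun x => ?_⟩
  have h1 := abs_le.1 (h1 x)
  have h2 := abs_le.1 (h2 x)
  simp only [Pi.add_apply]
  rw [abs_le]; constructor <;> linarith

lemma Cl_smul (hS : IsRiesz S) (hT : IsRiesz T) (hu : u ∈ S) (hv : v ∈ T) (hu0 : 0 ≤ u)
    (hv0 : 0 ≤ v) {F : X × Y → ℝ} (c : ℝ) (hF : F ∈ Cl hS hT hu hv hu0 hv0) :
    c • F ∈ Cl hS hT hu hv hu0 hv0 := by
  intro ε hε
  obtain ⟨s, hs, h1⟩ := hF (ε/(|c|+1)) (by positivity)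
  refine ⟨c • s, Subalgebra.smul_mem _ hs c, fun x => ?_⟩
  simp only [Pi.smul_apply, smul_eq_mul]
  rw [← mul_sub, abs_mul]
  calc |c| * |F x - s x| ≤ (|c| + 1) * (ε/(|c|+1)) :=
        mul_le_mul (by linarith) (h1 x) (abs_nonneg _) (by positivity)
    _ = ε := by field_simp

/-- the class of functions represented over all large `u`, `v` -/
def Rep (hS : IsRiesz S) (hT : IsRiesz T) : Set (X × Y → ℝ) :=
  { f | ∃ u₀ ∈ S, ∃ v₀ ∈ T, 0 ≤ u₀ ∧ 0 ≤ v₀ ∧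
    ∀ (u : X → ℝ) (v : Y → ℝ) (hu : u ∈ S) (hv : v ∈ T) (hu0 : 0 ≤ u) (hv0 : 0 ≤ v),
      u₀ ≤ u → v₀ ≤ v →
      ∃ F ∈ Cl hS hT hu hv hu0 hv0, ∀ z, f z = F z * (u z.1 * v z.2) }

lemma Rep_tensor (hS : IsRiesz S) (hT : IsRiesz T) {g : X → ℝ} {h : Y → ℝ}
    (hg : g ∈ S) (hh : h ∈ T) : tensor g h ∈ Rep hS hT := by
  refine ⟨|g|, hS.2 _ hg, |h|, hT.2 _ hh, abs_nonneg _, abs_nonneg _, ?_⟩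
  intro u v hu hv hu0 hv0 hgu hhv
  refine ⟨tensor (fun x => g x / u x) (fun y => h y / v y), fun ε hε =>
    ⟨_, Algebra.subset_adjoin ⟨_, Mul_div hu0 hg hgu, _, Mul_div hv0 hh hhv, rfl⟩,
      fun z => by simpa using hε.le⟩, fun z => ?_⟩
  have h1 : g z.1 / u z.1 * u z.1 = g z.1 := div_mul_cancel_of_imp fun e => by
    have : |g z.1| ≤ u z.1 := hgu z.1
    rw [e] at this; exact abs_nonpos_iff.1 this
  have h2 : h z.2 / v z.2 * v z.2 = h z.2 := div_mul_cancel_of_imp fun e => by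
    have : |h z.2| ≤ v z.2 := hhv z.2
    rw [e] at this; exact abs_nonpos_iff.1 this
  simp only [tensor]
  rw [mul_mul_mul_comm, h1, h2]

lemma Rep_zero (hS : IsRiesz S) (hT : IsRiesz T) : (0 : X × Y → ℝ) ∈ Rep hS hT := by
  have := Rep_tensor hS hT hS.1.1 hT.1.1
  have e : tensor (0 : X → ℝ) (0 : Y → ℝ) = 0 := by ext; simp [tensor]
  rwa [e] at this

lemma Rep_riesz (hS : IsRiesz S) (hT : IsRiesz T) : IsRiesz (Rep hS hT) := by
  refine ⟨⟨Rep_zero hS hT, ?_, ?_⟩, ?_⟩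
  · rintro f g ⟨u, hu, v, hv, hu0, hv0, hf⟩ ⟨u', hu', v', hv', hu0', hv0', hg⟩
    refine ⟨u + u', hS.1.2.1 _ _ hu hu', v + v', hT.1.2.1 _ _ hv hv', add_nonneg hu0 hu0',
      add_nonneg hv0 hv0', ?_⟩
    intro a b ha hb ha0 hb0 h1 h2
    obtain ⟨F, hF, e⟩ := hf a b ha hb ha0 hb0 ((le_add_of_nonneg_right hu0').trans h1)
      ((le_add_of_nonneg_right hv0').trans h2)
    obtain ⟨G, hG, e'⟩ := hg a b ha hb ha0 hb0 ((le_add_of_nonneg_left hu0).trans h1)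
      ((le_add_of_nonneg_left hv0).trans h2)
    refine ⟨F + G, Cl_add hS hT ha hb ha0 hb0 hF hG, fun z => ?_⟩
    simp only [Pi.add_apply, e, e']; ring
  · rintro c f ⟨u, hu, v, hv, hu0, hv0, hf⟩
    refine ⟨u, hu, v, hv, hu0, hv0, fun a b ha hb ha0 hb0 h1 h2 => ?_⟩
    obtain ⟨F, hF, e⟩ := hf a b ha hb ha0 hb0 h1 h2
    refine ⟨c • F, Cl_smul hS hT ha hb ha0 hb0 c hF, fun z => ?_⟩
    simp only [Pi.smul_apply, smul_eq_mul, e]; ring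
  · rintro f ⟨u, hu, v, hv, hu0, hv0, hf⟩
    refine ⟨u, hu, v, hv, hu0, hv0, fun a b ha hb ha0 hb0 h1 h2 => ?_⟩
    obtain ⟨F, hF, e⟩ := hf a b ha hb ha0 hb0 h1 h2
    refine ⟨|F|, Cl_abs hS hT ha hb ha0 hb0 hF, fun z => ?_⟩
    have hw : 0 ≤ a z.1 * b z.2 := mul_nonneg (ha0 _) (hb0 _)
    simp only [Pi.abs_apply, e, abs_mul _ (a z.1 * b z.2), abs_of_nonneg hw]

lemma approx (hS : IsRiesz S) (hT : IsRiesz T) {f : X × Y → ℝ} (hf : f ∈ RGen (TensorSet S T)) :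
    ∃ u ∈ S, ∃ v ∈ T, ∀ ε > 0, ∃ t ∈ TensorSet S T,
      ∀ z, |f z - t z| ≤ ε * (u z.1 * v z.2) := by
  have hR : f ∈ Rep hS hT := by
    refine hf _ ⟨Rep_riesz hS hT, ?_⟩
    rintro _ ⟨k, g, h, hg, hh, rfl⟩
    exact IsSubspace.sum (Rep_riesz hS hT).1 _ fun i => Rep_tensor hS hT (hg i) (hh i)
  obtain ⟨u, hu, v, hv, hu0, hv0, H⟩ := hR
  obtain ⟨F, hF, e⟩ := H u v hu hv hu0 hv0 le_rfl le_rfl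
  refine ⟨u, hu, v, hv, fun ε hε => ?_⟩
  obtain ⟨G, hG, h⟩ := hF (ε/2) (by positivity)
  obtain ⟨t, ht, h'⟩ := (Alg_le_App hS hT hu hv hu0 hv0 hG).2 (ε/2) (by positivity)
  refine ⟨t, ht, fun z => ?_⟩
  have hw : 0 ≤ u z.1 * v z.2 := mul_nonneg (hu0 _) (hv0 _)
  have h' := h' z
  rw [e]
  set w := u z.1 * v z.2
  have h2 : |(F z - G z) * w| ≤ ε/2 * w := by
    rw [abs_mul, abs_of_nonneg hw]
    exact mul_le_mul_of_nonneg_right (h z) hw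
  have := abs_add_le ((F z - G z) * w) (G z * w - t z)
  rw [show F z * w - t z = (F z - G z) * w + (G z * w - t z) by ring]
  linarith

lemma sections (hT : IsRiesz T) {f : X × Y → ℝ}
    (hf : f ∈ RGen (TensorSet S T)) (x : X) : (fun y => f (x, y)) ∈ T := by
  refine hf { f | (fun y => f (x, y)) ∈ T } ⟨⟨⟨hT.1.1, fun f g hf hg => hT.1.2.1 _ _ hf hg,
    fun c f hf => hT.1.2.2 c _ hf⟩, fun f hf => hT.2 _ hf⟩, ?_⟩
  rintro _ ⟨k, g, h, hg, hh, rfl⟩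
  have := IsSubspace.sum hT.1 (fun i => g i x • h i) (fun i => hT.1.2.2 _ _ (hh i))
  show (fun y => (∑ i, tensor (g i) (h i)) (x, y)) ∈ T
  convert this using 1
  ext y; simp [tensor]

lemma sections' (hS : IsRiesz S) {f : X × Y → ℝ}
    (hf : f ∈ RGen (TensorSet S T)) (y : Y) : (fun x => f (x, y)) ∈ S := by
  refine hf { f | (fun x => f (x, y)) ∈ S } ⟨⟨⟨hS.1.1, fun f g hf hg => hS.1.2.1 _ _ hf hg,
    fun c f hf => hS.1.2.2 c _ hf⟩, fun f hf => hS.2 _ hf⟩, ?_⟩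
  rintro _ ⟨k, g, h, hg, hh, rfl⟩
  have := IsSubspace.sum hS.1 (fun i => h i y • g i) (fun i => hS.1.2.2 _ _ (hg i))
  show (fun x => (∑ i, tensor (g i) (h i)) (x, y)) ∈ S
  convert this using 1
  ext x; simp [tensor, mul_comm]

lemma half {Jb : (X → ℝ) → ℝ} {Kb : (Y → ℝ) → ℝ} (hS : IsRiesz S)
    (hJ : IsDaniell (LGen S) Jb) (hK : IsDaniell (LGen T) Kb)
    (f : X → Y → ℝ) (hf : ∀ x, f x ∈ LGen T) (c : ℝ) (hu : u ∈ S) (hv : v ∈ T)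
    (H : ∀ ε > 0, ∃ (k : ℕ) (g : Fin k → X → ℝ) (h : Fin k → Y → ℝ), (∀ i, g i ∈ S) ∧
      (∀ i, h i ∈ T) ∧ (∀ x y, |f x y - ∑ i, g i x * h i y| ≤ ε * (u x * v y)) ∧
      |c - ∑ i, Jb (g i) * Kb (h i)| ≤ ε * (Jb u * Kb v)) :
    (fun x => Kb (f x)) ∈ LGen S ∧ c = Jb (fun x => Kb (f x)) := by
  have key : ∀ ε > 0, ∃ s ∈ S, (∀ x, |Kb (f x) - s x| ≤ ε * (u x * Kb v)) ∧
      |c - Jb s| ≤ ε * (Jb u * Kb v) := by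
    intro ε hε
    obtain ⟨k, g, h, hg, hh, h1, h2⟩ := H ε hε
    have hgm : ∀ i, Kb (h i) • g i ∈ S := fun i => hS.1.2.2 _ _ (hg i)
    refine ⟨∑ i, Kb (h i) • g i, IsSubspace.sum hS.1 _ hgm, fun x => ?_, ?_⟩
    · have hm : ∀ i, g i x • h i ∈ LGen T := fun i => hK.1.1.2.2 _ _ (LGen_sub _ (hh i))
      have h3 := D_abs hK (hf x) (IsSubspace.sum hK.1.1 _ hm)
        (hK.1.1.2.2 (ε * u x) v (LGen_sub _ hv)) (fun y => by
          have := h1 x y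
          simpa [mul_assoc] using this)
      rw [D_sum hK _ hm, hK.2.2.1 _ _ (LGen_sub _ hv)] at h3
      simp only [hK.2.2.1 _ _ (LGen_sub _ (hh _))] at h3
      rw [mul_assoc] at h3
      simpa [mul_comm (Kb _) (g _ _)] using h3
    · rw [D_sum hJ _ (fun i => LGen_sub _ (hgm i))]
      simp only [hJ.2.2.1 _ _ (LGen_sub _ (hg _))]
      simpa [mul_comm] using h2
  have hmem : (fun x => Kb (f x)) ∈ LGen S := by
    choose s hs h1 h2 using fun n : ℕ => key (1 / ((n : ℝ) + 1)) (by positivity)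
    obtain ⟨s0, hs0, h0, -⟩ := key 1 one_pos
    have hu0 : ∀ x, 0 ≤ u x * Kb v := fun x => by
      have := (abs_nonneg _).trans (h0 x); linarith
    apply LGen_Pdom
    refine ⟨fun n => Nat.casesOn n (|s0| + (2 * Kb v) • u) s, ?_, ?_, ?_⟩
    · rintro (_ | n)
      · exact LGen_sub _ (hS.1.2.1 _ _ (hS.2 _ hs0) (hS.1.2.2 _ _ hu))
      · exact LGen_sub _ (hs n)
    · intro n x
      show |s n x| ≤ |s0 x| + (2 * Kb v) * u x
      have a := h1 n x
      have b := h0 x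
      have hle : 1 / ((n : ℝ) + 1) ≤ 1 := by
        rw [div_le_one (by positivity)]; linarith [(Nat.cast_nonneg n : (0:ℝ) ≤ n)]
      have a' := a.trans (mul_le_mul_of_nonneg_right hle (hu0 x))
      have d := abs_sub_le (s n x) (Kb (f x)) (s0 x)
      rw [abs_sub_comm] at a'
      have := abs_sub_abs_le_abs_sub (s n x) (s0 x)
      linarith
    · intro x
      rw [← tendsto_add_atTop_iff_nat 1]
      show Tendsto (fun n => s n x) atTop (𝓝 (Kb (f x)))
      rw [tendsto_iff_norm_sub_tendsto_zero]
      refine squeeze_zero (fun _ => norm_nonneg _)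
        (g := fun n : ℕ => 1 / ((n : ℝ) + 1) * (u x * Kb v)) (fun n => ?_) ?_
      · rw [Real.norm_eq_abs, abs_sub_comm]; exact h1 n x
      · simpa using (tendsto_one_div_add_atTop_nhds_zero_nat (𝕜 := ℝ)).mul_const (u x * Kb v)
  refine ⟨hmem, ?_⟩
  have hb : ∀ ε > 0, |c - Jb (fun x => Kb (f x))| ≤ ε * (2 * (Jb u * Kb v)) := by
    intro ε hε
    obtain ⟨s, hs, h1, h2⟩ := key ε hε
    have h3 := D_abs hJ hmem (LGen_sub _ hs) (hJ.1.1.2.2 (ε * Kb v) u (LGen_sub _ hu))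
      (fun x => by have := h1 x; simp only [Pi.smul_apply, smul_eq_mul]; linarith)
    rw [hJ.2.2.1 _ _ (LGen_sub _ hu), abs_sub_comm] at h3
    have := abs_sub_le c (Jb s) (Jb (fun x => Kb (f x)))
    linarith
  have h0 : 0 ≤ 2 * (Jb u * Kb v) := by
    have := (abs_nonneg _).trans (hb 1 one_pos); linarith
  have : |c - Jb (fun x => Kb (f x))| ≤ 0 := by
    refine le_of_forall_pos_le_add fun δ hδ => ?_
    refine (hb (δ / (2 * (Jb u * Kb v) + 1)) (by positivity)).trans ?_
    rw [zero_add, div_mul_eq_mul_div, div_le_iff₀ (by positivity)]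
    nlinarith
  linarith [abs_nonpos_iff.1 this]

end

end Fub

theorem stmt16 {X Y : Type*} (S : Set (X → ℝ)) (T : Set (Y → ℝ))
    (J : (X → ℝ) → ℝ) (K : (Y → ℝ) → ℝ)
    (Jbar : (X → ℝ) → ℝ) (Kbar : (Y → ℝ) → ℝ)
    (I : (X × Y → ℝ) → ℝ)
    (hS : IsRiesz S) (hT : IsRiesz T)
    (hJ : IsDaniell S J) (hK : IsDaniell T K)
    (hJbar : IsDaniell (LGen S) Jbar) (hJext : ∀ f ∈ S, Jbar f = J f)
    (hKbar : IsDaniell (LGen T) Kbar) (hKext : ∀ g ∈ T, Kbar g = K g)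
    (hI : IsDaniell (RGen (TensorSet S T)) I)
    (hprod : ∀ f ∈ S, ∀ g ∈ T, I (tensor f g) = J f * K g) :
    ∀ f ∈ RGen (TensorSet S T),
      (∀ x, (fun y => f (x, y)) ∈ LGen T) ∧
      (fun x => Kbar (fun y => f (x, y))) ∈ LGen S ∧
      (∀ y, (fun x => f (x, y)) ∈ LGen S) ∧
      (fun y => Jbar (fun x => f (x, y))) ∈ LGen T ∧
      I f = Jbar (fun x => Kbar (fun y => f (x, y))) ∧
      I f = Kbar (fun y => Jbar (fun x => f (x, y))) := by
  intro f hf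
  have hsec := fun x => Fub.LGen_sub T (Fub.sections hT hf x)
  have hsec' := fun y => Fub.LGen_sub S (Fub.sections' hS hf y)
  obtain ⟨u, hu, v, hv, H⟩ := Fub.approx hS hT hf
  have H' : ∀ ε > 0, ∃ (k : ℕ) (g : Fin k → X → ℝ) (h : Fin k → Y → ℝ), (∀ i, g i ∈ S) ∧
      (∀ i, h i ∈ T) ∧ (∀ x y, |f (x, y) - ∑ i, g i x * h i y| ≤ ε * (u x * v y)) ∧
      |I f - ∑ i, Jbar (g i) * Kbar (h i)| ≤ ε * (Jbar u * Kbar v) := by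
    intro ε hε
    obtain ⟨_, ⟨k, g, h, hg, hh, rfl⟩, h1⟩ := H ε hε
    refine ⟨k, g, h, hg, hh, fun x y => by simpa [tensor] using h1 (x, y), ?_⟩
    have hm : ∀ i, tensor (g i) (h i) ∈ RGen (TensorSet S T) :=
      fun i => Fub.RGen_sub _ (Fub.Tens_one (hg i) (hh i))
    have huv : tensor u v ∈ RGen (TensorSet S T) := Fub.RGen_sub _ (Fub.Tens_one hu hv)
    have h2 := Fub.D_abs hI hf (Fub.IsSubspace.sum hI.1.1 _ hm)
      (hI.1.1.2.2 ε _ huv) h1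
    rw [Fub.D_sum hI _ hm, hI.2.2.1 _ _ huv, hprod u hu v hv] at h2
    simp only [hprod _ (hg _) _ (hh _)] at h2
    simp only [hJext _ (hg _), hKext _ (hh _), hJext _ hu, hKext _ hv]
    exact h2
  obtain ⟨a1, a2⟩ := Fub.half hS hJbar hKbar (fun x y => f (x, y)) hsec (I f) hu hv H'
  obtain ⟨b1, b2⟩ := Fub.half hT hKbar hJbar (fun y x => f (x, y)) hsec' (I f) hv hu (by
    intro ε hε
    obtain ⟨k, g, h, hg, hh, h1, h2⟩ := H' ε hε
    refine ⟨k, h, g, hh, hg, fun y x => ?_, ?_⟩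
    · simpa only [mul_comm] using h1 x y
    · simpa only [mul_comm] using h2)
  exact ⟨hsec, a1, hsec', b1, a2, b2⟩
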